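/- Let d ≥ 1 and p ≥ 2 be integers with d(p − 1) < 2p. There exist θ ∈ (0, 1) and a constant C > 0, both depending only on d and p, such that for every ε > 0 and all continuously differentiable functions ψ¹, …, ψ^p : ℝ^d → ℝ with compact support, ‖ (∏_{j=1}^p ψ^j)² − ∏_{j=1}^p ((ψ^j)² ∗ p_ε) ‖₁ ≤ C ε^{θ/2} ( ∑_{j=1}^p ( ‖∇ψ^j‖₂² + ‖ψ^j‖₂² ) )^p. -/

import Mathlib

open Real MeasureTheory

/-- The Gaussian heat kernel `p_ε(x) = (2πε)^{-d/2} exp(-|x|²/(2ε))` on `ℝ^d`. -/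
noncomputable def heatKernel (d : ℕ) (ε : ℝ) (x : EuclideanSpace ℝ (Fin d)) : ℝ :=
  (2 * Real.pi * ε) ^ (-(d : ℝ) / 2) * Real.exp (-‖x‖ ^ 2 / (2 * ε))

/-- Convolution of `f` with the Gaussian heat kernel `p_ε`. -/
noncomputable def heatConv (d : ℕ) (ε : ℝ) (f : EuclideanSpace ℝ (Fin d) → ℝ)
    (x : EuclideanSpace ℝ (Fin d)) : ℝ :=
  ∫ y, heatKernel d ε (x - y) * f y

/-- The `L^r` norm (w.r.t. Lebesgue measure) of `f : ℝ^d → ℝ`. -/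
noncomputable def Lnorm (d : ℕ) (r : ℝ) (f : EuclideanSpace ℝ (Fin d) → ℝ) : ℝ :=
  (∫ x, |f x| ^ r) ^ (1 / r)

/-- The `L²` norm of the gradient of `ψ : ℝ^d → ℝ`. -/
noncomputable def gradNorm2 (d : ℕ) (ψ : EuclideanSpace ℝ (Fin d) → ℝ) : ℝ :=
  (∫ x, ‖fderiv ℝ ψ x‖ ^ 2) ^ (1 / (2 : ℝ))

open scoped ENNReal NNReal

lemma ENNReal.two_mul_le_sq_add_sq (a b : ℝ≥0∞) : 2 * a * b ≤ a ^ 2 + b ^ 2 := by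
  rcases eq_or_ne a ∞ with rfl | ha
  · simp
  rcases eq_or_ne b ∞ with rfl | hb
  · simp
  lift a to ℝ≥0 using ha
  lift b to ℝ≥0 using hb
  exact_mod_cast _root_.two_mul_le_add_sq a b

lemma ContDiff.measurable_enorm_fderiv {E : Type*} [NormedAddCommGroup E] [NormedSpace ℝ E]
    [MeasurableSpace E] [BorelSpace E] {ψ : E → ℝ} (hψ : ContDiff ℝ 1 ψ) :
    Measurable fun x => ‖fderiv ℝ ψ x‖ₑ :=
  (hψ.continuous_fderiv one_ne_zero).enorm.measurable

lemma ContDiff.measurable_enorm {E : Type*} [NormedAddCommGroup E] [NormedSpace ℝ E]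
    [MeasurableSpace E] [BorelSpace E] {ψ : E → ℝ} (hψ : ContDiff ℝ 1 ψ) :
    Measurable fun x => ‖ψ x‖ₑ :=
  hψ.continuous.enorm.measurable

lemma enorm_fderiv_pow {E : Type*} [NormedAddCommGroup E] [NormedSpace ℝ E]
    {ψ : E → ℝ} (hψ : ContDiff ℝ 1 ψ) (n : ℕ) (x : E) :
    ‖fderiv ℝ (fun z => ψ z ^ (n + 1)) x‖ₑ
      = (n + 1 : ℕ) * ‖ψ x‖ₑ ^ n * ‖fderiv ℝ ψ x‖ₑ := by
  have h := ((hψ.differentiable one_ne_zero x).hasFDerivAt.pow (n + 1)).fderiv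
  rw [h, enorm_smul]
  simp [enorm_mul, enorm_pow, -Nat.cast_add]

lemma HasCompactSupport.pow_succ {X : Type*} [TopologicalSpace X] {ψ : X → ℝ} (hψ : HasCompactSupport ψ) (n : ℕ) :
    HasCompactSupport fun x => ψ x ^ (n + 1) :=
  hψ.comp_left (g := fun t : ℝ => t ^ (n + 1)) (by simp)

section Sobolev

variable {E : Type*} [NormedAddCommGroup E] [InnerProductSpace ℝ E] [FiniteDimensional ℝ E]
  [MeasurableSpace E] [BorelSpace E]

/-- The squared `H¹` norm of `ψ`, as an extended nonnegative real. -/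
noncomputable def sobolevSq (ψ : E → ℝ) : ℝ≥0∞ :=
  (∫⁻ x, ‖fderiv ℝ ψ x‖ₑ ^ 2) + ∫⁻ x, ‖ψ x‖ₑ ^ 2

lemma lintegral_enorm_sq_le_sobolevSq (ψ : E → ℝ) : ∫⁻ x, ‖ψ x‖ₑ ^ 2 ≤ sobolevSq ψ :=
  le_add_self

lemma lintegral_enorm_fderiv_sq_le_sobolevSq (ψ : E → ℝ) :
    ∫⁻ x, ‖fderiv ℝ ψ x‖ₑ ^ 2 ≤ sobolevSq ψ :=
  le_self_add

lemma lintegral_two_mul_enorm_mul_fderiv_le {ψ : E → ℝ} (hψ : ContDiff ℝ 1 ψ) :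
    ∫⁻ x, 2 * ‖ψ x‖ₑ * ‖fderiv ℝ ψ x‖ₑ ≤ sobolevSq ψ := by
  rw [sobolevSq, add_comm, ← lintegral_add_left (hψ.measurable_enorm.pow_const 2)]
  exact lintegral_mono fun x => ENNReal.two_mul_le_sq_add_sq _ _

/-- In dimension two, `H¹` embeds in every `L^{2k}`. -/
lemma exists_lintegral_enorm_pow_le_of_finrank_eq_two (hE : Module.finrank ℝ E = 2) (k : ℕ) :
    ∃ C : ℝ≥0, ∀ ψ : E → ℝ, ContDiff ℝ 1 ψ → HasCompactSupport ψ →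
      ∫⁻ x, ‖ψ x‖ₑ ^ (2 * (k + 1)) ≤ C * sobolevSq ψ ^ (k + 1) := by
  induction k with
  | zero => exact ⟨1, fun ψ _ _ => by simpa using lintegral_enorm_sq_le_sobolevSq ψ⟩
  | succ k ih =>
    obtain ⟨C, hC⟩ := ih
    let K := lintegralPowLePowLIntegralFDerivConst (volume : Measure E) 2
    refine ⟨K * (k + 2 : ℕ) ^ 2 * C, fun ψ hψ hc => ?_⟩
    have hconj : Real.HolderConjugate (Module.finrank ℝ E) 2 := by
      rw [hE]; exact_mod_cast Real.HolderConjugate.two_two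
    have key := lintegral_pow_le_pow_lintegral_fderiv (volume : Measure E) (hψ.pow (k + 2))
      (hc.pow_succ (k + 1)) hconj
    have hCS : (∫⁻ x, ‖ψ x‖ₑ ^ (k + 1) * ‖fderiv ℝ ψ x‖ₑ) ^ 2
        ≤ (∫⁻ x, ‖ψ x‖ₑ ^ (2 * (k + 1))) * ∫⁻ x, ‖fderiv ℝ ψ x‖ₑ ^ 2 := by
      have h := ENNReal.lintegral_mul_norm_pow_le (μ := (volume : Measure E))
        (f := fun x => ‖ψ x‖ₑ ^ (2 * (k + 1))) (g := fun x => ‖fderiv ℝ ψ x‖ₑ ^ 2)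
        (hψ.measurable_enorm.pow_const _).aemeasurable
        (hψ.measurable_enorm_fderiv.pow_const _).aemeasurable
        (p := 1 / 2) (q := 1 / 2) (by norm_num) (by norm_num) (by norm_num)
      have e1 : ∀ t : ℝ≥0∞, (t ^ (2 : ℕ)) ^ (1 / 2 : ℝ) = t := fun t => by
        rw [← ENNReal.rpow_natCast, ← ENNReal.rpow_mul]; norm_num
      have e2 : ∀ t : ℝ≥0∞, (t ^ (1 / 2 : ℝ)) ^ (2 : ℕ) = t := fun t => by
        rw [← ENNReal.rpow_natCast, ← ENNReal.rpow_mul]; norm_num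
      simp only [mul_comm 2 (k + 1), pow_mul, e1] at h ⊢
      calc _ ≤ _ := pow_le_pow_left₀ zero_le h 2
        _ = _ := by rw [mul_pow, e2, e2]
    have e3 : ∀ t : ℝ≥0∞, t ^ (2 : ℝ) = t ^ (2 : ℕ) := ENNReal.rpow_two
    simp only [e3, enorm_fderiv_pow hψ (k + 1), enorm_pow, ← pow_mul] at key
    calc ∫⁻ x, ‖ψ x‖ₑ ^ (2 * (k + 1 + 1)) = ∫⁻ x, ‖ψ x‖ₑ ^ ((k + 2) * 2) := by
          simp only [mul_comm 2]
      _ ≤ _ := key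
      _ = K * (((k + 2 : ℕ) : ℝ≥0∞) ^ 2
            * (∫⁻ x, ‖ψ x‖ₑ ^ (k + 1) * ‖fderiv ℝ ψ x‖ₑ) ^ 2) := by
          simp_rw [mul_assoc]
          have hm : Measurable fun x => ‖ψ x‖ₑ ^ (k + 1) * ‖fderiv ℝ ψ x‖ₑ :=
            (hψ.measurable_enorm.pow_const _).mul hψ.measurable_enorm_fderiv
          rw [lintegral_const_mul _ hm, mul_pow]
      _ ≤ K * (((k + 2 : ℕ) : ℝ≥0∞) ^ 2 * ((C * sobolevSq ψ ^ (k + 1)) * sobolevSq ψ)) := by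
          gcongr
          exact hCS.trans (mul_le_mul' (hC ψ hψ hc) (lintegral_enorm_fderiv_sq_le_sobolevSq ψ))
      _ = _ := by push_cast; ring

/-- In dimension one, `H¹` embeds in `L^∞`. -/
lemma enorm_sq_le_sobolevSq_of_finrank_eq_one (hE : Module.finrank ℝ E = 1)
    {ψ : E → ℝ} (hψ : ContDiff ℝ 1 ψ) (hc : HasCompactSupport ψ) (x : E) :
    ‖ψ x‖ₑ ^ 2 ≤ sobolevSq ψ := by
  have b : OrthonormalBasis (Fin 1) ℝ E := (stdOrthonormalBasis ℝ E).reindex (finCongr hE)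
  let L : ℝ ≃ₗᵢ[ℝ] E := (OrthonormalBasis.singleton (Fin 1) ℝ).repr.trans b.repr.symm
  have hmp : MeasurePreserving L := L.measurePreserving
  let u : ℝ → ℝ := fun t => ψ (L t) ^ 2
  have hu : ContDiff ℝ 1 u := (hψ.comp L.contDiff).pow 2
  have huc : HasCompactSupport u :=
    (hc.comp_homeomorph L.toHomeomorph).comp_left (g := fun t : ℝ => t ^ 2) (by simp)
  have hder : ∀ t, ‖deriv u t‖ₑ ≤ 2 * ‖ψ (L t)‖ₑ * ‖fderiv ℝ ψ (L t)‖ₑ := by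
    intro t
    have h1 : HasDerivAt (fun t => ψ (L t)) (fderiv ℝ ψ (L t) (L 1)) t := by
      have := (hψ.differentiable one_ne_zero (L t)).hasFDerivAt.comp_hasDerivAt t
        (L.toContinuousLinearEquiv.toContinuousLinearMap.hasDerivAt (x := t))
      exact this
    have h2 := (h1.pow 2).deriv
    rw [show u = (fun t => ψ (L t)) ^ 2 from rfl, h2]
    have h3 : ‖fderiv ℝ ψ (L t) (L 1)‖ₑ ≤ ‖fderiv ℝ ψ (L t)‖ₑ := by
      simpa using (fderiv ℝ ψ (L t)).le_opENorm (L 1)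
    have h4 : ‖((2 : ℕ) : ℝ)‖ₑ = 2 := by rw [enorm_natCast]; rfl
    rw [enorm_mul, enorm_mul, h4, pow_one]
    gcongr
  calc ‖ψ x‖ₑ ^ 2 = ‖u (L.symm x)‖ₑ := by simp [u, enorm_pow]
    _ ≤ ∫⁻ t in Set.Iic (L.symm x), ‖deriv u t‖ₑ := huc.enorm_le_lintegral_Ici_deriv hu _
    _ ≤ ∫⁻ t, ‖deriv u t‖ₑ := setLIntegral_le_lintegral _ _
    _ ≤ ∫⁻ t, 2 * ‖ψ (L t)‖ₑ * ‖fderiv ℝ ψ (L t)‖ₑ := lintegral_mono hder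
    _ = ∫⁻ x, 2 * ‖ψ x‖ₑ * ‖fderiv ℝ ψ x‖ₑ :=
      hmp.lintegral_comp (f := fun x => 2 * ‖ψ x‖ₑ * ‖fderiv ℝ ψ x‖ₑ)
        ((hψ.measurable_enorm.const_mul 2).mul hψ.measurable_enorm_fderiv)
    _ ≤ _ := lintegral_two_mul_enorm_mul_fderiv_le hψ

/-- Subcritical Sobolev embedding of `H¹` into some `L^{2q}` with `q > p`. -/
lemma exists_lintegral_enorm_rpow_le {p : ℕ} (hp : 2 ≤ p) (hd : 1 ≤ Module.finrank ℝ E)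
    (hsub : (Module.finrank ℝ E : ℝ) * ((p : ℝ) - 1) < 2 * p) :
    ∃ q : ℝ, p < q ∧ ∃ C : ℝ≥0, ∀ ψ : E → ℝ, ContDiff ℝ 1 ψ → HasCompactSupport ψ →
      ∫⁻ x, (‖ψ x‖ₑ ^ 2) ^ q ≤ C * sobolevSq ψ ^ q := by
  have hp' : (2 : ℝ) ≤ p := by exact_mod_cast hp
  obtain hd | hd | hd : Module.finrank ℝ E = 1 ∨ Module.finrank ℝ E = 2 ∨
      3 ≤ Module.finrank ℝ E := by omega
  · refine ⟨(p + 1 : ℕ), by simp, 1, fun ψ hψ hc => ?_⟩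
    simp only [ENNReal.rpow_natCast, pow_succ _ p]
    calc ∫⁻ x, (‖ψ x‖ₑ ^ 2) ^ p * ‖ψ x‖ₑ ^ 2
        ≤ ∫⁻ x, sobolevSq ψ ^ p * ‖ψ x‖ₑ ^ 2 := by
          gcongr with x
          exact enorm_sq_le_sobolevSq_of_finrank_eq_one hd hψ hc x
      _ = sobolevSq ψ ^ p * ∫⁻ x, ‖ψ x‖ₑ ^ 2 :=
          lintegral_const_mul _ (hψ.measurable_enorm.pow_const 2)
      _ ≤ _ := by
          simp only [ENNReal.coe_one, one_mul]
          gcongr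
          exact lintegral_enorm_sq_le_sobolevSq ψ
  · obtain ⟨C, hC⟩ := exists_lintegral_enorm_pow_le_of_finrank_eq_two hd p
    refine ⟨(p + 1 : ℕ), by simp, C, fun ψ hψ hc => ?_⟩
    simp only [ENNReal.rpow_natCast, ← pow_mul]
    exact hC ψ hψ hc
  · set d : ℝ := (Module.finrank ℝ E : ℝ) with hd_def
    have hd3 : (3 : ℝ) ≤ d := by simpa [d] using (Nat.cast_le (α := ℝ)).2 hd
    have hq : (0 : ℝ) < d / (d - 2) := by apply div_pos <;> linarith
    refine ⟨d / (d - 2), ?_, ?_⟩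
    · rw [lt_div_iff₀ (by linarith)]; nlinarith
    set q : ℝ := d / (d - 2) with hq_def
    let r : ℝ≥0 := ⟨2 * q, by positivity⟩
    let K := SNormLESNormFDerivOfEqConst ℝ (volume : Measure E) (2 : ℝ≥0)
    have hrr : (r : ℝ) = 2 * q := rfl
    refine ⟨K ^ (2 * q), fun ψ hψ hc => ?_⟩
    have h := eLpNorm_le_eLpNorm_fderiv_of_eq (volume : Measure E) hψ hc (p := 2) (p' := r)
      (by norm_num) (by omega) (by
        rw [hrr, hq_def, ← hd_def]
        have : d - 2 ≠ 0 := by linarith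
        have : d ≠ 0 := by linarith
        push_cast
        field_simp)
    have hr0 : (r : ℝ≥0∞) ≠ 0 := by
      simp only [ne_eq, ENNReal.coe_eq_zero]
      intro h0
      rw [h0] at hrr
      simp at hrr
      linarith
    rw [eLpNorm_eq_lintegral_rpow_enorm_toReal hr0 ENNReal.coe_ne_top,
      eLpNorm_eq_lintegral_rpow_enorm_toReal (by simp) (by simp)] at h
    simp only [ENNReal.coe_toReal, hrr, NNReal.coe_ofNat, ENNReal.rpow_two] at h
    have h2 := ENNReal.rpow_le_rpow h (by positivity : 0 ≤ 2 * q)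
    have e : 1 / (2 * q) * (2 * q) = 1 := by field_simp
    rw [← ENNReal.rpow_mul, e, ENNReal.rpow_one, ENNReal.mul_rpow_of_nonneg _ _ (by positivity),
      ← ENNReal.rpow_mul, show 1 / 2 * (2 * q) = q by ring] at h2
    simp only [← ENNReal.rpow_two, ← ENNReal.rpow_mul]
    refine h2.trans ?_
    rw [ENNReal.coe_rpow_of_nonneg _ (by positivity)]
    exact mul_le_mul' le_rfl (ENNReal.rpow_le_rpow
      (lintegral_enorm_fderiv_sq_le_sobolevSq ψ) hq.le)

end Sobolev

lemma ENNReal.lintegral_rpow_le_interpolate {α : Type*} [MeasurableSpace α] {μ : Measure α}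
    {h : α → ℝ≥0∞} (hh : Measurable h) {p q : ℝ} (hp : 1 ≤ p) (hpq : p < q) :
    ∫⁻ x, h x ^ p ∂μ
      ≤ (∫⁻ x, h x ∂μ) ^ ((q - p) / (q - 1)) * (∫⁻ x, h x ^ q ∂μ) ^ ((p - 1) / (q - 1)) := by
  have hq : 0 < q - 1 := by linarith
  have ha : 0 ≤ (q - p) / (q - 1) := div_nonneg (by linarith) hq.le
  have hb : 0 ≤ (p - 1) / (q - 1) := div_nonneg (by linarith) hq.le
  have key := ENNReal.lintegral_mul_norm_pow_le (μ := μ) hh.aemeasurable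
    (hh.pow_const q).aemeasurable ha hb (by rw [← add_div, div_eq_one_iff_eq hq.ne']; ring)
  refine le_trans (le_of_eq (lintegral_congr fun x => ?_)) key
  rw [← ENNReal.rpow_mul, ← ENNReal.rpow_add_of_nonneg _ _ ha (mul_nonneg (by linarith) hb)]
  congr 1
  field_simp
  ring

/-- Jensen's inequality for a probability density. -/
lemma ENNReal.lintegral_mul_rpow_le_lintegral {α : Type*} [MeasurableSpace α] {μ : Measure α}
    {κ h : α → ℝ≥0∞} (hκ : Measurable κ) (hh : Measurable h) (hκ1 : ∫⁻ x, κ x ∂μ = 1)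
    {p : ℝ} (hp : 1 ≤ p) :
    (∫⁻ x, κ x * h x ∂μ) ^ p ≤ ∫⁻ x, κ x * h x ^ p ∂μ := by
  have hp0 : 0 < p := by linarith
  have h1 : 0 ≤ 1 - 1 / p := by
    rw [sub_nonneg, div_le_one hp0]; exact hp
  have h2 : 0 ≤ 1 / p := by positivity
  have key := ENNReal.lintegral_mul_norm_pow_le (μ := μ) hκ.aemeasurable
    (hκ.mul (hh.pow_const p)).aemeasurable h1 h2 (by ring)
  have e : ∀ x, κ x ^ (1 - 1 / p) * (κ * fun x => h x ^ p) x ^ (1 / p) = κ x * h x := by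
    intro x
    rw [Pi.mul_apply, ENNReal.mul_rpow_of_nonneg _ _ h2, ← mul_assoc,
      ← ENNReal.rpow_add_of_nonneg _ _ h1 h2, ← ENNReal.rpow_mul]
    rw [show 1 - 1 / p + 1 / p = 1 by ring, show p * (1 / p) = 1 by field_simp]
    simp
  simp only [e, hκ1, ENNReal.one_rpow, one_mul] at key
  calc _ ≤ _ := ENNReal.rpow_le_rpow key hp0.le
    _ = _ := by
      rw [← ENNReal.rpow_mul, show 1 / p * p = 1 by field_simp, ENNReal.rpow_one]
      rfl

lemma enorm_sub_le_lintegral_fderiv {E : Type*} [NormedAddCommGroup E] [NormedSpace ℝ E]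
    {g : E → ℝ} (hg : ContDiff ℝ 1 g) (x y : E) :
    ‖g x - g (x - y)‖ₑ ≤ ∫⁻ t in Set.Ioc (0 : ℝ) 1, ‖fderiv ℝ g (x - t • y)‖ₑ * ‖y‖ₑ := by
  have hder : ∀ t : ℝ, HasDerivAt (fun t : ℝ => g (x - t • y)) (fderiv ℝ g (x - t • y) (-y)) t := by
    intro t
    have h1 : HasDerivAt (fun t : ℝ => x - t • y) (-y) t := by
      simpa using ((hasDerivAt_id t).smul_const y).const_sub x
    exact (hg.differentiable one_ne_zero _).hasFDerivAt.comp_hasDerivAt t h1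
  have hcont : Continuous fun t : ℝ => fderiv ℝ g (x - t • y) (-y) :=
    ((hg.continuous_fderiv one_ne_zero).comp (by fun_prop)).clm_apply continuous_const
  have hint := intervalIntegral.integral_eq_sub_of_hasDerivAt (a := 0) (b := 1)
    (fun t _ => hder t) (hcont.intervalIntegrable _ _)
  have e : ‖g x - g (x - y)‖ₑ = ‖∫ t in (0 : ℝ)..1, fderiv ℝ g (x - t • y) (-y)‖ₑ := by
    rw [hint, ← enorm_neg]; simp
  rw [e, intervalIntegral.integral_of_le zero_le_one]
  refine (enorm_integral_le_lintegral_enorm _).trans (lintegral_mono fun t => ?_)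
  simpa using (fderiv ℝ g (x - t • y)).le_opENorm (-y)

section Translation

variable {E : Type*} [NormedAddCommGroup E] [InnerProductSpace ℝ E] [FiniteDimensional ℝ E]
  [MeasurableSpace E] [BorelSpace E]

lemma lintegral_enorm_sub_translate_le {g : E → ℝ} (hg : ContDiff ℝ 1 g) (y : E) :
    ∫⁻ x, ‖g x - g (x - y)‖ₑ ≤ ‖y‖ₑ * ∫⁻ x, ‖fderiv ℝ g x‖ₑ := by
  have hc := hg.continuous_fderiv one_ne_zero
  calc ∫⁻ x, ‖g x - g (x - y)‖ₑ
      ≤ ∫⁻ x, ∫⁻ t in Set.Ioc (0 : ℝ) 1, ‖fderiv ℝ g (x - t • y)‖ₑ * ‖y‖ₑ :=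
        lintegral_mono fun x => enorm_sub_le_lintegral_fderiv hg x y
    _ = ∫⁻ t in Set.Ioc (0 : ℝ) 1, ∫⁻ x, ‖fderiv ℝ g (x - t • y)‖ₑ * ‖y‖ₑ := by
        refine lintegral_lintegral_swap (Measurable.aemeasurable ?_)
        have : Continuous fun z : E × ℝ => ‖fderiv ℝ g (z.1 - z.2 • y)‖ₑ :=
          (hc.comp (by fun_prop)).enorm
        exact this.measurable.mul_const _
    _ = ∫⁻ t in Set.Ioc (0 : ℝ) 1, ‖y‖ₑ * ∫⁻ x, ‖fderiv ℝ g x‖ₑ := by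
        refine lintegral_congr fun t => ?_
        rw [lintegral_sub_right_eq_self (fun x => ‖fderiv ℝ g x‖ₑ * ‖y‖ₑ) (t • y),
          lintegral_mul_const _ hc.enorm.measurable, mul_comm]
    _ = _ := by simp

lemma lintegral_enorm_sq_sub_translate_le {ψ : E → ℝ} (hψ : ContDiff ℝ 1 ψ) (y : E) :
    ∫⁻ x, ‖ψ x ^ 2 - ψ (x - y) ^ 2‖ₑ ≤ ‖y‖ₑ * sobolevSq ψ := by
  refine (lintegral_enorm_sub_translate_le (hψ.pow 2) y).trans ?_
  gcongr
  refine le_trans (le_of_eq (lintegral_congr fun x => ?_)) (lintegral_two_mul_enorm_mul_fderiv_le hψ)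
  rw [enorm_fderiv_pow hψ 1 x]
  norm_num

/-- Squares of `H¹` functions are Hölder continuous in `L^p` under translation,
in the subcritical regime. -/
lemma exists_lintegral_enorm_sq_sub_translate_rpow_le {p : ℕ} (hp : 2 ≤ p)
    (hd : 1 ≤ Module.finrank ℝ E)
    (hsub : (Module.finrank ℝ E : ℝ) * ((p : ℝ) - 1) < 2 * p) :
    ∃ a ∈ Set.Ioo (0 : ℝ) 1, ∃ C : ℝ≥0, ∀ ψ : E → ℝ, ContDiff ℝ 1 ψ → HasCompactSupport ψ →
      ∫⁻ x, ‖ψ x ^ 2‖ₑ ^ (p : ℝ) ≤ C * sobolevSq ψ ^ (p : ℝ) ∧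
      ∀ y, ∫⁻ x, ‖ψ x ^ 2 - ψ (x - y) ^ 2‖ₑ ^ (p : ℝ)
        ≤ C * ‖y‖ₑ ^ a * sobolevSq ψ ^ (p : ℝ) := by
  obtain ⟨q, hpq, C, hC⟩ := exists_lintegral_enorm_rpow_le hp hd hsub
  have hp' : (2 : ℝ) ≤ p := by exact_mod_cast hp
  have hq1 : 0 < q - 1 := by linarith
  set a : ℝ := (q - p) / (q - 1) with ha_def
  set b : ℝ := (p - 1) / (q - 1) with hb_def
  have ha : 0 ≤ a := div_nonneg (by linarith) hq1.le
  have hb : 0 ≤ b := div_nonneg (by linarith) hq1.le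
  have hab : a + q * b = p := by rw [ha_def, hb_def]; field_simp; ring
  let D : ℝ≥0 := 2 ^ (q - 1) * (2 * C)
  refine ⟨a, ⟨div_pos (by linarith) hq1, (div_lt_one hq1).2 (by linarith)⟩, C ^ b + D ^ b,
    fun ψ hψ hc => ?_⟩
  have hm : Measurable fun x => ‖ψ x ^ 2‖ₑ := (hψ.continuous.pow 2).enorm.measurable
  have hCψ : ∫⁻ x, ‖ψ x ^ 2‖ₑ ^ q ≤ C * sobolevSq ψ ^ q := by
    simpa only [enorm_pow] using hC ψ hψ hc
  have hpow : ∀ (K : ℝ≥0) (S : ℝ≥0∞), S ^ a * (K * S ^ q) ^ b = (K ^ b : ℝ≥0) * S ^ (p : ℝ) := by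
    intro K S
    rw [ENNReal.mul_rpow_of_nonneg _ _ hb, ← ENNReal.rpow_mul, ENNReal.coe_rpow_of_nonneg _ hb,
      mul_left_comm, ← ENNReal.rpow_add_of_nonneg _ _ ha (by nlinarith), hab]
  constructor
  · calc ∫⁻ x, ‖ψ x ^ 2‖ₑ ^ (p : ℝ)
        ≤ (∫⁻ x, ‖ψ x ^ 2‖ₑ) ^ a * (∫⁻ x, ‖ψ x ^ 2‖ₑ ^ q) ^ b :=
          ENNReal.lintegral_rpow_le_interpolate hm (by linarith) hpq
      _ ≤ sobolevSq ψ ^ a * (C * sobolevSq ψ ^ q) ^ b := by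
          gcongr
          simpa only [enorm_pow] using lintegral_enorm_sq_le_sobolevSq ψ
      _ = (C ^ b : ℝ≥0) * sobolevSq ψ ^ (p : ℝ) := hpow _ _
      _ ≤ _ := by
          gcongr
          exact le_self_add
  · intro y
    have hmy : Measurable fun x => ‖ψ (x - y) ^ 2‖ₑ := hm.comp (measurable_id.sub_const y)
    have hdiff : Measurable fun x => ‖ψ x ^ 2 - ψ (x - y) ^ 2‖ₑ :=
      ((hψ.continuous.pow 2).sub
        ((hψ.continuous.comp (continuous_sub_right y)).pow 2)).enorm.measurable
    have hD : ∫⁻ x, ‖ψ x ^ 2 - ψ (x - y) ^ 2‖ₑ ^ q ≤ D * sobolevSq ψ ^ q := by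
      calc ∫⁻ x, ‖ψ x ^ 2 - ψ (x - y) ^ 2‖ₑ ^ q
          ≤ ∫⁻ x, 2 ^ (q - 1) * (‖ψ x ^ 2‖ₑ ^ q + ‖ψ (x - y) ^ 2‖ₑ ^ q) := by
            refine lintegral_mono fun x => ?_
            exact (ENNReal.rpow_le_rpow enorm_sub_le (by linarith)).trans
              (ENNReal.rpow_add_le_mul_rpow_add_rpow _ _ (by linarith))
        _ = 2 ^ (q - 1) * (2 * ∫⁻ x, ‖ψ x ^ 2‖ₑ ^ q) := by
            have hadd : Measurable fun x => ‖ψ x ^ 2‖ₑ ^ q + ‖ψ (x - y) ^ 2‖ₑ ^ q :=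
              (hm.pow_const q).add (hmy.pow_const q)
            rw [lintegral_const_mul _ hadd, lintegral_add_left (hm.pow_const q),
              lintegral_sub_right_eq_self (fun x => ‖ψ x ^ 2‖ₑ ^ q) y, two_mul]
        _ ≤ 2 ^ (q - 1) * (2 * (C * sobolevSq ψ ^ q)) := by gcongr
        _ = _ := by
            simp only [D, ENNReal.coe_mul, ENNReal.coe_rpow_of_nonneg _ hq1.le, ENNReal.coe_ofNat]
            ring
    calc ∫⁻ x, ‖ψ x ^ 2 - ψ (x - y) ^ 2‖ₑ ^ (p : ℝ)
        ≤ (∫⁻ x, ‖ψ x ^ 2 - ψ (x - y) ^ 2‖ₑ) ^ a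
            * (∫⁻ x, ‖ψ x ^ 2 - ψ (x - y) ^ 2‖ₑ ^ q) ^ b :=
          ENNReal.lintegral_rpow_le_interpolate hdiff (by linarith) hpq
      _ ≤ (‖y‖ₑ * sobolevSq ψ) ^ a * (D * sobolevSq ψ ^ q) ^ b := by
          gcongr
          exact lintegral_enorm_sq_sub_translate_le hψ y
      _ = (D ^ b : ℝ≥0) * ‖y‖ₑ ^ a * sobolevSq ψ ^ (p : ℝ) := by
          rw [ENNReal.mul_rpow_of_nonneg _ _ ha, mul_assoc, hpow]; ring
      _ ≤ _ := by
          gcongr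
          exact le_add_self

end Translation
section HeatKernel

variable {d : ℕ}

local notation "𝔼" => EuclideanSpace ℝ (Fin d)

lemma continuous_heatKernel (ε : ℝ) : Continuous (heatKernel d ε) := by
  unfold heatKernel
  fun_prop

lemma heatKernel_nonneg {ε : ℝ} (hε : 0 < ε) (x : 𝔼) : 0 ≤ heatKernel d ε x := by
  unfold heatKernel
  positivity

lemma integral_heatKernel {ε : ℝ} (hε : 0 < ε) : ∫ x, heatKernel d ε x = 1 := by
  have h := GaussianFourier.integral_rexp_neg_mul_sq_norm (V := 𝔼) (b := 1 / (2 * ε))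
    (by positivity)
  simp only [heatKernel]
  rw [integral_const_mul]
  have e : ∀ x : 𝔼, -‖x‖ ^ 2 / (2 * ε) = -(1 / (2 * ε)) * ‖x‖ ^ 2 := fun x => by ring
  simp only [e, h, finrank_euclideanSpace, Fintype.card_fin]
  rw [show π / (1 / (2 * ε)) = 2 * π * ε by field_simp, ← Real.rpow_add (by positivity)]
  rw [show -(d : ℝ) / 2 + (d : ℝ) / 2 = 0 by ring, Real.rpow_zero]

lemma integrable_heatKernel {ε : ℝ} (hε : 0 < ε) : Integrable (heatKernel d ε) :=
  Integrable.of_integral_ne_zero (by rw [integral_heatKernel hε]; exact one_ne_zero)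

lemma lintegral_enorm_heatKernel {ε : ℝ} (hε : 0 < ε) : ∫⁻ x, ‖heatKernel d ε x‖ₑ = 1 := by
  have h := ofReal_integral_eq_lintegral_ofReal (integrable_heatKernel (d := d) hε)
    (Filter.Eventually.of_forall (heatKernel_nonneg hε))
  rw [integral_heatKernel hε, ENNReal.ofReal_one] at h
  rw [h]
  exact lintegral_congr fun x => Real.enorm_of_nonneg (heatKernel_nonneg hε x)

lemma heatKernel_mul_norm_rpow_le {ε : ℝ} (hε : 0 < ε) {a : ℝ} (ha : a ∈ Set.Ioo (0 : ℝ) 1)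
    (x : 𝔼) :
    heatKernel d ε x * ‖x‖ ^ a
      ≤ 4 * 2 ^ ((d : ℝ) / 2) * ε ^ (a / 2) * heatKernel d (2 * ε) x := by
  set s : ℝ := ‖x‖ ^ 2 / ε with hs
  have hs0 : 0 ≤ s := by positivity
  have h1 : ‖x‖ ^ a = ε ^ (a / 2) * s ^ (a / 2) := by
    rw [← Real.mul_rpow hε.le hs0, hs, mul_div_cancel₀ _ hε.ne', ← Real.rpow_natCast,
      ← Real.rpow_mul (norm_nonneg x)]
    congr 1
    push_cast
    ring
  have h2 : s ^ (a / 2) ≤ 4 * Real.exp (s / 4) := by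
    have h3 : s ^ (a / 2) ≤ 1 + s := by
      rcases le_total s 1 with h | h
      · linarith [Real.rpow_le_one hs0 h (by linarith [ha.1] : 0 ≤ a / 2)]
      · have := Real.rpow_le_rpow_of_exponent_le h (by linarith [ha.2] : a / 2 ≤ 1)
        rw [Real.rpow_one] at this
        linarith
    linarith [Real.add_one_le_exp (s / 4)]
  have h4 : heatKernel d ε x
      = 2 ^ ((d : ℝ) / 2) * heatKernel d (2 * ε) x * Real.exp (-(s / 4)) := by
    have e0 : (2 * π * (2 * ε)) ^ (-(d : ℝ) / 2)
        = 2 ^ (-(d : ℝ) / 2) * (2 * π * ε) ^ (-(d : ℝ) / 2) := by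
      rw [show 2 * π * (2 * ε) = 2 * (2 * π * ε) by ring]
      exact Real.mul_rpow zero_le_two (by positivity)
    have e1 : (2 : ℝ) ^ ((d : ℝ) / 2) * 2 ^ (-(d : ℝ) / 2) = 1 := by
      rw [← Real.rpow_add (by norm_num), show (d : ℝ) / 2 + -(d : ℝ) / 2 = 0 by ring,
        Real.rpow_zero]
    have e2 : Real.exp (-‖x‖ ^ 2 / (2 * ε))
        = Real.exp (-‖x‖ ^ 2 / (2 * (2 * ε))) * Real.exp (-(s / 4)) := by
      rw [← Real.exp_add, hs]
      congr 1
      field_simp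
      ring
    simp only [heatKernel]
    rw [e2, e0]
    linear_combination (-(2 * π * ε) ^ (-(d : ℝ) / 2)
      * Real.exp (-‖x‖ ^ 2 / (2 * (2 * ε))) * Real.exp (-(s / 4))) * e1
  have hk := heatKernel_nonneg (d := d) (by positivity : 0 < 2 * ε) x
  have h5 : Real.exp (-(s / 4)) * s ^ (a / 2) ≤ 4 := by
    calc _ ≤ Real.exp (-(s / 4)) * (4 * Real.exp (s / 4)) := by gcongr
      _ = 4 * Real.exp (-(s / 4) + s / 4) := by rw [Real.exp_add]; ring
      _ = 4 := by simp
  calc heatKernel d ε x * ‖x‖ ^ a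
      = 2 ^ ((d : ℝ) / 2) * heatKernel d (2 * ε) x * ε ^ (a / 2)
          * (Real.exp (-(s / 4)) * s ^ (a / 2)) := by rw [h1, h4]; ring
    _ ≤ 2 ^ ((d : ℝ) / 2) * heatKernel d (2 * ε) x * ε ^ (a / 2) * 4 := by gcongr
    _ = _ := by ring

lemma lintegral_heatKernel_mul_enorm_rpow_le {ε : ℝ} (hε : 0 < ε) {a : ℝ}
    (ha : a ∈ Set.Ioo (0 : ℝ) 1) :
    ∫⁻ x : 𝔼, ‖heatKernel d ε x‖ₑ * ‖x‖ₑ ^ a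
      ≤ ENNReal.ofReal (4 * 2 ^ ((d : ℝ) / 2) * ε ^ (a / 2)) := by
  calc ∫⁻ x : 𝔼, ‖heatKernel d ε x‖ₑ * ‖x‖ₑ ^ a
      ≤ ∫⁻ x : 𝔼, ENNReal.ofReal (4 * 2 ^ ((d : ℝ) / 2) * ε ^ (a / 2))
          * ‖heatKernel d (2 * ε) x‖ₑ := by
        refine lintegral_mono fun x => ?_
        rw [Real.enorm_of_nonneg (heatKernel_nonneg hε x),
          Real.enorm_of_nonneg (heatKernel_nonneg (by positivity) x), ← ofReal_norm,
          ENNReal.ofReal_rpow_of_nonneg (norm_nonneg x) ha.1.le,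
          ← ENNReal.ofReal_mul (heatKernel_nonneg hε x), ← ENNReal.ofReal_mul (by positivity)]
        exact ENNReal.ofReal_le_ofReal (heatKernel_mul_norm_rpow_le hε ha x)
    _ = _ := by
        rw [lintegral_const_mul _ (continuous_heatKernel _).enorm.measurable,
          lintegral_enorm_heatKernel (by positivity), mul_one]

lemma heatConv_eq_integral_translate (ε : ℝ) (f : 𝔼 → ℝ) (x : 𝔼) :
    heatConv d ε f x = ∫ y, heatKernel d ε y * f (x - y) := by
  rw [heatConv, ← integral_sub_left_eq_self (fun y => heatKernel d ε y * f (x - y)) volume x]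
  simp

lemma integrable_heatKernel_mul_translate {ε : ℝ} (hε : 0 < ε) {f : 𝔼 → ℝ} (hf : Continuous f)
    (hc : HasCompactSupport f) (x : 𝔼) :
    Integrable fun y => heatKernel d ε y * f (x - y) := by
  obtain ⟨B, hB⟩ := hf.bounded_above_of_compact_support hc
  exact (integrable_heatKernel hε).mul_bdd (c := B)
    (hf.comp (continuous_sub_left x)).aestronglyMeasurable
    (Filter.Eventually.of_forall fun y => hB _)

lemma enorm_heatConv_le (ε : ℝ) (f : 𝔼 → ℝ) (x : 𝔼) :
    ‖heatConv d ε f x‖ₑ ≤ ∫⁻ y, ‖heatKernel d ε y‖ₑ * ‖f (x - y)‖ₑ := by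
  rw [heatConv_eq_integral_translate]
  refine (enorm_integral_le_lintegral_enorm _).trans (le_of_eq ?_)
  simp only [enorm_mul]

lemma enorm_sub_heatConv_le {ε : ℝ} (hε : 0 < ε) {f : 𝔼 → ℝ} (hf : Continuous f)
    (hc : HasCompactSupport f) (x : 𝔼) :
    ‖f x - heatConv d ε f x‖ₑ ≤ ∫⁻ y, ‖heatKernel d ε y‖ₑ * ‖f x - f (x - y)‖ₑ := by
  have e : f x - heatConv d ε f x = ∫ y, heatKernel d ε y * (f x - f (x - y)) := by
    simp only [mul_sub]
    rw [integral_sub ((integrable_heatKernel hε).mul_const _)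
      (integrable_heatKernel_mul_translate hε hf hc x), integral_mul_const,
      integral_heatKernel hε, one_mul, heatConv_eq_integral_translate]
  rw [e]
  refine (enorm_integral_le_lintegral_enorm _).trans (le_of_eq ?_)
  simp only [enorm_mul]

lemma lintegral_rpow_heatKernel_average_le {ε : ℝ} (hε : 0 < ε) {p : ℝ} (hp : 1 ≤ p)
    {h : 𝔼 → 𝔼 → ℝ≥0∞} (hh : Measurable (Function.uncurry h)) :
    ∫⁻ x, (∫⁻ y, ‖heatKernel d ε y‖ₑ * h x y) ^ p
      ≤ ∫⁻ y, ‖heatKernel d ε y‖ₑ * ∫⁻ x, h x y ^ p := by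
  have hκ : Measurable fun y => ‖heatKernel d ε y‖ₑ := (continuous_heatKernel ε).enorm.measurable
  calc ∫⁻ x, (∫⁻ y, ‖heatKernel d ε y‖ₑ * h x y) ^ p
      ≤ ∫⁻ x, ∫⁻ y, ‖heatKernel d ε y‖ₑ * h x y ^ p :=
        lintegral_mono fun x => ENNReal.lintegral_mul_rpow_le_lintegral hκ
          hh.of_uncurry_left (lintegral_enorm_heatKernel hε) hp
    _ = ∫⁻ y, ∫⁻ x, ‖heatKernel d ε y‖ₑ * h x y ^ p := by
        refine lintegral_lintegral_swap (Measurable.aemeasurable ?_)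
        exact (hκ.comp measurable_snd).mul (hh.pow_const p)
    _ = _ := by
        refine lintegral_congr fun y => ?_
        have : Measurable fun x => h x y ^ p := hh.of_uncurry_right.pow_const p
        rw [lintegral_const_mul _ this]

lemma measurable_heatConv (ε : ℝ) {f : 𝔼 → ℝ} (hf : Continuous f) :
    Measurable (heatConv d ε f) := by
  have : StronglyMeasurable (Function.uncurry fun x y : 𝔼 => heatKernel d ε (x - y) * f y) := by
    refine Continuous.stronglyMeasurable ?_
    exact ((continuous_heatKernel ε).comp (continuous_fst.sub continuous_snd)).mul
      (hf.comp continuous_snd)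
  exact this.integral_prod_right.measurable

lemma lintegral_enorm_heatConv_rpow_le {ε : ℝ} (hε : 0 < ε) {p : ℝ} (hp : 1 ≤ p) {f : 𝔼 → ℝ}
    (hf : Continuous f) :
    ∫⁻ x, ‖heatConv d ε f x‖ₑ ^ p ≤ ∫⁻ x, ‖f x‖ₑ ^ p := by
  have hm : Measurable (Function.uncurry fun x y : 𝔼 => ‖f (x - y)‖ₑ) :=
    (hf.comp (continuous_fst.sub continuous_snd)).enorm.measurable
  calc ∫⁻ x, ‖heatConv d ε f x‖ₑ ^ p
      ≤ ∫⁻ x, (∫⁻ y, ‖heatKernel d ε y‖ₑ * ‖f (x - y)‖ₑ) ^ p := by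
        gcongr with x
        exact enorm_heatConv_le ε f x
    _ ≤ ∫⁻ y, ‖heatKernel d ε y‖ₑ * ∫⁻ x, ‖f (x - y)‖ₑ ^ p :=
        lintegral_rpow_heatKernel_average_le hε hp hm
    _ = ∫⁻ y, ‖heatKernel d ε y‖ₑ * ∫⁻ x, ‖f x‖ₑ ^ p := by
        refine lintegral_congr fun y => ?_
        rw [lintegral_sub_right_eq_self (fun x => ‖f x‖ₑ ^ p) y]
    _ = _ := by
        rw [lintegral_mul_const _ (continuous_heatKernel ε).enorm.measurable,
          lintegral_enorm_heatKernel hε, one_mul]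

/-- A translation modulus of continuity in `L^p` controls the heat smoothing error in `L^p`. -/
lemma lintegral_enorm_sub_heatConv_rpow_le {ε : ℝ} (hε : 0 < ε) {p : ℝ} (hp : 1 ≤ p) {f : 𝔼 → ℝ}
    (hf : Continuous f) (hc : HasCompactSupport f) {a : ℝ} (ha : a ∈ Set.Ioo (0 : ℝ) 1)
    {K : ℝ≥0∞} (hK : ∀ y, ∫⁻ x, ‖f x - f (x - y)‖ₑ ^ p ≤ ‖y‖ₑ ^ a * K) :
    ∫⁻ x, ‖f x - heatConv d ε f x‖ₑ ^ p
      ≤ ENNReal.ofReal (4 * 2 ^ ((d : ℝ) / 2) * ε ^ (a / 2)) * K := by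
  have hm : Measurable (Function.uncurry fun x y : 𝔼 => ‖f x - f (x - y)‖ₑ) :=
    ((hf.comp continuous_fst).sub (hf.comp (continuous_fst.sub continuous_snd))).enorm.measurable
  calc ∫⁻ x, ‖f x - heatConv d ε f x‖ₑ ^ p
      ≤ ∫⁻ x, (∫⁻ y, ‖heatKernel d ε y‖ₑ * ‖f x - f (x - y)‖ₑ) ^ p := by
        gcongr with x
        exact enorm_sub_heatConv_le hε hf hc x
    _ ≤ ∫⁻ y, ‖heatKernel d ε y‖ₑ * ∫⁻ x, ‖f x - f (x - y)‖ₑ ^ p :=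
        lintegral_rpow_heatKernel_average_le hε hp hm
    _ ≤ ∫⁻ y, (‖heatKernel d ε y‖ₑ * ‖y‖ₑ ^ a) * K := by
        refine lintegral_mono fun y => ?_
        rw [mul_assoc]
        exact mul_le_mul' le_rfl (hK y)
    _ = (∫⁻ y, ‖heatKernel d ε y‖ₑ * ‖y‖ₑ ^ a) * K := by
        refine lintegral_mul_const _ ?_
        exact (continuous_heatKernel ε).enorm.measurable.mul (measurable_enorm.pow_const a)
    _ ≤ _ := mul_le_mul' (lintegral_heatKernel_mul_enorm_rpow_le hε ha) le_rfl

end HeatKernel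
section Product

lemma enorm_prod_sub_prod_le {ι : Type*} [DecidableEq ι] (s : Finset ι) (a b : ι → ℝ) :
    ‖∏ j ∈ s, a j - ∏ j ∈ s, b j‖ₑ
      ≤ ∑ k ∈ s, ∏ j ∈ s, (if j = k then ‖a j - b j‖ₑ else ‖a j‖ₑ + ‖b j‖ₑ) := by
  induction s using Finset.induction with
  | empty => simp
  | insert i s hi ih =>
    have h1 : ∏ j ∈ s, (if j = i then ‖a j - b j‖ₑ else ‖a j‖ₑ + ‖b j‖ₑ)
        = ∏ j ∈ s, (‖a j‖ₑ + ‖b j‖ₑ) :=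
      Finset.prod_congr rfl fun j hj => if_neg (ne_of_mem_of_not_mem hj hi)
    have h2 : ∀ k ∈ s, ∏ j ∈ insert i s, (if j = k then ‖a j - b j‖ₑ else ‖a j‖ₑ + ‖b j‖ₑ)
        = (‖a i‖ₑ + ‖b i‖ₑ) * ∏ j ∈ s, (if j = k then ‖a j - b j‖ₑ else ‖a j‖ₑ + ‖b j‖ₑ) :=
      fun k hk => by
        rw [Finset.prod_insert hi, if_neg (ne_of_mem_of_not_mem hk hi).symm]
    rw [Finset.sum_insert hi, Finset.prod_insert hi, Finset.prod_insert hi, Finset.prod_insert hi,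
      if_pos rfl, h1, Finset.sum_congr rfl h2, ← Finset.mul_sum]
    have e : a i * ∏ j ∈ s, a j - b i * ∏ j ∈ s, b j
        = (a i - b i) * ∏ j ∈ s, a j + b i * (∏ j ∈ s, a j - ∏ j ∈ s, b j) := by ring
    have h3 : ‖∏ j ∈ s, a j‖ₑ ≤ ∏ j ∈ s, (‖a j‖ₑ + ‖b j‖ₑ) := by
      have : ‖∏ j ∈ s, a j‖ₑ = ∏ j ∈ s, ‖a j‖ₑ := by
        simp only [enorm, nnnorm_prod, ENNReal.ofNNReal_finsetProd]
      rw [this]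
      exact Finset.prod_le_prod' fun j _ => le_self_add
    rw [e]
    refine (enorm_add_le _ _).trans ?_
    rw [enorm_mul, enorm_mul]
    exact add_le_add (mul_le_mul' le_rfl h3) (mul_le_mul' le_add_self ih)

/-- Stability of products of `p` functions in `L^p`. -/
lemma lintegral_enorm_prod_sub_prod_le {α : Type*} [MeasurableSpace α] {μ : Measure α} {p : ℕ}
    (hp : 1 ≤ p) {f g : Fin p → α → ℝ} (hf : ∀ j, Measurable (f j)) (hg : ∀ j, Measurable (g j))
    {A B : ℝ≥0∞} {S : Fin p → ℝ≥0∞}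
    (hfA : ∀ j, ∫⁻ x, ‖f j x‖ₑ ^ (p : ℝ) ∂μ ≤ A * S j ^ (p : ℝ))
    (hgA : ∀ j, ∫⁻ x, ‖g j x‖ₑ ^ (p : ℝ) ∂μ ≤ A * S j ^ (p : ℝ))
    (hB : ∀ j, ∫⁻ x, ‖f j x - g j x‖ₑ ^ (p : ℝ) ∂μ ≤ B * S j ^ (p : ℝ)) :
    ∫⁻ x, ‖∏ j, f j x - ∏ j, g j x‖ₑ ∂μ
      ≤ p * (B ^ (1 / (p : ℝ)) * (2 ^ (p : ℝ) * A) ^ (((p - 1 : ℕ) : ℝ) / p)) * ∏ j, S j := by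
  have hp1 : (1 : ℝ) ≤ p := by exact_mod_cast hp
  have hp0 : (0 : ℝ) < p := by linarith
  let h : Fin p → Fin p → α → ℝ≥0∞ := fun k j x =>
    if j = k then ‖f j x - g j x‖ₑ else ‖f j x‖ₑ + ‖g j x‖ₑ
  have hm : ∀ k j, Measurable (h k j) := by
    intro k j
    by_cases hjk : j = k
    · simp only [h, hjk, if_true]
      exact ((hf k).sub (hg k)).enorm
    · simp only [h, hjk, if_false]
      exact (hf j).enorm.add (hg j).enorm
  have hbound : ∀ k j, (∫⁻ x, h k j x ^ (p : ℝ) ∂μ) ^ (1 / (p : ℝ))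
      ≤ (if j = k then B ^ (1 / (p : ℝ)) else (2 ^ (p : ℝ) * A) ^ (1 / (p : ℝ))) * S j := by
    intro k j
    have e : ∀ M : ℝ≥0∞, (M * S j ^ (p : ℝ)) ^ (1 / (p : ℝ)) = M ^ (1 / (p : ℝ)) * S j := by
      intro M
      rw [ENNReal.mul_rpow_of_nonneg _ _ (by positivity), ← ENNReal.rpow_mul,
        mul_one_div_cancel hp0.ne', ENNReal.rpow_one]
    split_ifs with hjk
    · rw [← e]
      refine ENNReal.rpow_le_rpow ?_ (by positivity)
      simpa only [h, hjk, if_true] using hB k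
    · rw [← e]
      refine ENNReal.rpow_le_rpow ?_ (by positivity)
      simp only [h, hjk, if_false]
      calc ∫⁻ x, (‖f j x‖ₑ + ‖g j x‖ₑ) ^ (p : ℝ) ∂μ
          ≤ ∫⁻ x, 2 ^ ((p : ℝ) - 1) * (‖f j x‖ₑ ^ (p : ℝ) + ‖g j x‖ₑ ^ (p : ℝ)) ∂μ :=
            lintegral_mono fun x => ENNReal.rpow_add_le_mul_rpow_add_rpow _ _ hp1
        _ = 2 ^ ((p : ℝ) - 1)
              * (∫⁻ x, ‖f j x‖ₑ ^ (p : ℝ) ∂μ + ∫⁻ x, ‖g j x‖ₑ ^ (p : ℝ) ∂μ) := by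
            have hadd : Measurable fun x => ‖f j x‖ₑ ^ (p : ℝ) + ‖g j x‖ₑ ^ (p : ℝ) :=
              ((hf j).enorm.pow_const _).add ((hg j).enorm.pow_const _)
            rw [lintegral_const_mul _ hadd, lintegral_add_left ((hf j).enorm.pow_const _)]
        _ ≤ 2 ^ ((p : ℝ) - 1) * (A * S j ^ (p : ℝ) + A * S j ^ (p : ℝ)) := by
            gcongr
            · exact hfA j
            · exact hgA j
        _ = 2 ^ ((p : ℝ) - 1) * 2 ^ (1 : ℝ) * A * S j ^ (p : ℝ) := by
            rw [ENNReal.rpow_one]; ring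
        _ = _ := by
            rw [← ENNReal.rpow_add _ _ two_ne_zero ENNReal.ofNat_ne_top, sub_add_cancel]
  have hterm : ∀ k, ∫⁻ x, ∏ j, h k j x ∂μ
      ≤ B ^ (1 / (p : ℝ)) * (2 ^ (p : ℝ) * A) ^ (((p - 1 : ℕ) : ℝ) / p) * ∏ j, S j := by
    intro k
    have hH := ENNReal.lintegral_prod_norm_pow_le (μ := μ) Finset.univ
      (f := fun j x => h k j x ^ (p : ℝ)) (p := fun _ => 1 / (p : ℝ))
      (fun j _ => ((hm k j).pow_const _).aemeasurable)
      (by simp [hp0.ne']) (fun _ _ => by positivity)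
    simp only [← ENNReal.rpow_mul, mul_one_div_cancel hp0.ne', ENNReal.rpow_one] at hH
    refine hH.trans ((Finset.prod_le_prod' fun j _ => hbound k j).trans (le_of_eq ?_))
    rw [Finset.prod_mul_distrib]
    congr 1
    rw [← Finset.mul_prod_erase _ _ (Finset.mem_univ k), if_pos rfl]
    congr 1
    rw [Finset.prod_congr rfl fun j hj => if_neg (Finset.ne_of_mem_erase hj), Finset.prod_const,
      Finset.card_erase_of_mem (Finset.mem_univ k), Finset.card_univ, Fintype.card_fin,
      ← ENNReal.rpow_natCast, ← ENNReal.rpow_mul]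
    congr 1
    ring
  calc ∫⁻ x, ‖∏ j, f j x - ∏ j, g j x‖ₑ ∂μ
      ≤ ∫⁻ x, ∑ k, ∏ j, h k j x ∂μ :=
        lintegral_mono fun x => enorm_prod_sub_prod_le Finset.univ (f · x) (g · x)
    _ = ∑ k, ∫⁻ x, ∏ j, h k j x ∂μ :=
        lintegral_finsetSum _ fun k _ => Finset.measurable_fun_prod _ fun j _ => hm k j
    _ ≤ ∑ k : Fin p,
          B ^ (1 / (p : ℝ)) * (2 ^ (p : ℝ) * A) ^ (((p - 1 : ℕ) : ℝ) / p) * ∏ j, S j :=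
        Finset.sum_le_sum fun k _ => hterm k
    _ = _ := by simp [mul_assoc]

end Product

lemma sobolevSq_eq_ofReal {d : ℕ} {ψ : EuclideanSpace ℝ (Fin d) → ℝ} (hψ : ContDiff ℝ 1 ψ)
    (hc : HasCompactSupport ψ) :
    sobolevSq ψ = ENNReal.ofReal (gradNorm2 d ψ ^ 2 + Lnorm d 2 ψ ^ 2) := by
  have hsq : ∀ t : ℝ, 0 ≤ t → (t ^ (1 / (2 : ℝ))) ^ 2 = t := by
    intro t ht
    rw [← Real.sqrt_eq_rpow, Real.sq_sqrt ht]
  have h1 : gradNorm2 d ψ ^ 2 = ∫ x, ‖fderiv ℝ ψ x‖ ^ 2 :=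
    hsq _ (integral_nonneg fun x => by positivity)
  have h2 : Lnorm d 2 ψ ^ 2 = ∫ x, ‖ψ x‖ ^ 2 := by
    rw [Lnorm, hsq _ (integral_nonneg fun x => by positivity)]
    simp
  have s1 : HasCompactSupport fun x => ‖fderiv ℝ ψ x‖ ^ 2 :=
    (hc.fderiv ℝ).norm.comp_left (g := fun t : ℝ => t ^ 2) (by simp)
  have s2 : HasCompactSupport fun x => ‖ψ x‖ ^ 2 :=
    hc.norm.comp_left (g := fun t : ℝ => t ^ 2) (by simp)
  have i1 : Integrable fun x => ‖fderiv ℝ ψ x‖ ^ 2 :=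
    ((hψ.continuous_fderiv one_ne_zero).norm.pow 2).integrable_of_hasCompactSupport s1
  have i2 : Integrable fun x => ‖ψ x‖ ^ 2 :=
    (hψ.continuous.norm.pow 2).integrable_of_hasCompactSupport s2
  rw [h1, h2, ENNReal.ofReal_add (integral_nonneg fun x => by positivity)
      (integral_nonneg fun x => by positivity),
    ofReal_integral_eq_lintegral_ofReal i1 (Filter.Eventually.of_forall fun x => by positivity),
    ofReal_integral_eq_lintegral_ofReal i2 (Filter.Eventually.of_forall fun x => by positivity),
    sobolevSq]
  simp only [ENNReal.ofReal_pow (norm_nonneg _), ofReal_norm]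

theorem product_smoothing_L1_bound (d p : ℕ) (hd : 1 ≤ d) (hp : 2 ≤ p)
    (hsub : (d : ℝ) * ((p : ℝ) - 1) < 2 * p) :
    ∃ θ : ℝ, θ ∈ Set.Ioo (0 : ℝ) 1 ∧ ∃ C : ℝ, 0 < C ∧
      ∀ ε : ℝ, 0 < ε → ∀ ψ : Fin p → EuclideanSpace ℝ (Fin d) → ℝ,
        (∀ j, ContDiff ℝ 1 (ψ j)) → (∀ j, HasCompactSupport (ψ j)) →
          Lnorm d 1 (fun x =>
              (∏ j : Fin p, ψ j x) ^ 2 - ∏ j : Fin p, heatConv d ε (fun y => ψ j y ^ 2) x) ≤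
            C * ε ^ (θ / 2) *
              (∑ j : Fin p, (gradNorm2 d (ψ j) ^ 2 + Lnorm d 2 (ψ j) ^ 2)) ^ p := by
  have hp1 : (1 : ℝ) ≤ p := by exact_mod_cast (by omega : 1 ≤ p)
  have hp0 : (0 : ℝ) < p := by linarith
  obtain ⟨a, ha, A, hA⟩ := exists_lintegral_enorm_sq_sub_translate_rpow_le
    (E := EuclideanSpace ℝ (Fin d)) hp (by simpa using hd) (by simpa using hsub)
  let M : ℝ := 4 * 2 ^ ((d : ℝ) / 2)
  have hM : 0 < M := by positivity
  let C : ℝ := p * ((M * A) ^ (1 / (p : ℝ)) * (2 ^ (p : ℝ) * A) ^ (((p - 1 : ℕ) : ℝ) / p))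
  have hC : 0 ≤ C := by positivity
  refine ⟨a / p, ⟨div_pos ha.1 hp0, (div_lt_one hp0).2 (by linarith [ha.2])⟩, C + 1,
    by positivity, fun ε hε ψ hψ hc => ?_⟩
  let f : Fin p → EuclideanSpace ℝ (Fin d) → ℝ := fun j x => ψ j x ^ 2
  let g : Fin p → EuclideanSpace ℝ (Fin d) → ℝ := fun j => heatConv d ε (f j)
  let s : Fin p → ℝ := fun j => gradNorm2 d (ψ j) ^ 2 + Lnorm d 2 (ψ j) ^ 2
  have hs : ∀ j, 0 ≤ s j := fun j => by positivity
  have hfc : ∀ j, Continuous (f j) := fun j => (hψ j).continuous.pow 2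
  have hfs : ∀ j, HasCompactSupport (f j) := fun j => (hc j).pow_succ 1
  have hgm : ∀ j, Measurable (g j) := fun j => measurable_heatConv ε (hfc j)
  have key := lintegral_enorm_prod_sub_prod_le (μ := volume) (by omega : 1 ≤ p) (f := f) (g := g)
    (fun j => (hfc j).measurable) hgm (A := A) (B := ENNReal.ofReal (M * ε ^ (a / 2)) * A)
    (S := fun j => sobolevSq (ψ j)) (fun j => (hA (ψ j) (hψ j) (hc j)).1)
    (fun j => (lintegral_enorm_heatConv_rpow_le hε hp1 (hfc j)).trans
      (hA (ψ j) (hψ j) (hc j)).1)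
    (fun j => by
      rw [mul_assoc]
      refine lintegral_enorm_sub_heatConv_rpow_le hε hp1 (hfc j) (hfs j) ha fun y => ?_
      refine ((hA (ψ j) (hψ j) (hc j)).2 y).trans (le_of_eq ?_)
      ring)
  have hconst : (p : ℝ≥0∞) * ((ENNReal.ofReal (M * ε ^ (a / 2)) * A) ^ (1 / (p : ℝ))
      * (2 ^ (p : ℝ) * A) ^ (((p - 1 : ℕ) : ℝ) / p)) * ∏ j, sobolevSq (ψ j)
      = ENNReal.ofReal (C * ε ^ (a / p / 2) * ∏ j, s j) := by
    have e1 : ENNReal.ofReal (M * ε ^ (a / 2)) * A = ENNReal.ofReal (M * A * ε ^ (a / 2)) := by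
      rw [show (A : ℝ≥0∞) = ENNReal.ofReal A from (ENNReal.ofReal_coe_nnreal).symm,
        ← ENNReal.ofReal_mul (by positivity)]
      congr 1
      ring
    have e2 : (2 : ℝ≥0∞) ^ (p : ℝ) * A = ENNReal.ofReal (2 ^ (p : ℝ) * A) := by
      rw [ENNReal.ofReal_mul (by positivity), ENNReal.ofReal_coe_nnreal,
        ← ENNReal.ofReal_rpow_of_nonneg zero_le_two hp0.le, ENNReal.ofReal_ofNat]
    have e3 : (M * A * ε ^ (a / 2)) ^ (1 / (p : ℝ))
        = (M * A) ^ (1 / (p : ℝ)) * ε ^ (a / p / 2) := by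
      rw [Real.mul_rpow (by positivity) (by positivity), ← Real.rpow_mul hε.le]
      congr 2
      field_simp
    have e4 : ∏ j, sobolevSq (ψ j) = ENNReal.ofReal (∏ j, s j) := by
      rw [ENNReal.ofReal_prod_of_nonneg fun j _ => hs j]
      exact Finset.prod_congr rfl fun j _ => sobolevSq_eq_ofReal (hψ j) (hc j)
    rw [e1, e2, e4, ENNReal.ofReal_rpow_of_nonneg (by positivity) (by positivity),
      ENNReal.ofReal_rpow_of_nonneg (by positivity) (by positivity), e3,
      ← ENNReal.ofReal_natCast, ← ENNReal.ofReal_mul (by positivity),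
      ← ENNReal.ofReal_mul (by positivity), ← ENNReal.ofReal_mul (by positivity)]
    congr 1
    ring
  rw [hconst] at key
  have hprod0 : 0 ≤ ∏ j, s j := Finset.prod_nonneg fun j _ => hs j
  have hprod : ∏ j, s j ≤ (∑ j, s j) ^ p := by
    calc ∏ j, s j ≤ ∏ _j : Fin p, ∑ i, s i :=
          Finset.prod_le_prod (fun j _ => hs j) fun j _ =>
            Finset.single_le_sum (fun i _ => hs i) (Finset.mem_univ j)
      _ = _ := by simp
  have hL : Lnorm d 1 (fun x => (∏ j, ψ j x) ^ 2 - ∏ j, g j x)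
      = ∫ x, ‖∏ j, f j x - ∏ j, g j x‖ := by
    simp only [Lnorm, Real.rpow_one, div_one, f, Finset.prod_pow, Real.norm_eq_abs]
  have hmeas : Measurable fun x => ∏ j, f j x - ∏ j, g j x :=
    (Finset.measurable_fun_prod _ fun j _ => (hfc j).measurable).sub
      (Finset.measurable_fun_prod _ fun j _ => hgm j)
  calc Lnorm d 1 (fun x => (∏ j, ψ j x) ^ 2 - ∏ j, g j x)
      = (∫⁻ x, ‖∏ j, f j x - ∏ j, g j x‖ₑ).toReal := by
        rw [hL, integral_norm_eq_lintegral_enorm hmeas.aestronglyMeasurable]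
    _ ≤ C * ε ^ (a / p / 2) * ∏ j, s j :=
        ENNReal.toReal_le_of_le_ofReal (by positivity) key
    _ ≤ (C + 1) * ε ^ (a / p / 2) * (∑ j, s j) ^ p := by
        gcongr
        linarith
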